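/- arXiv:1707.00839 — 2 statements merged into one kernel-verified Lean document; each statement's English description precedes it below -/
import Mathlib

section
/- Let P, Q, R, P̃, Q̃ ∈ ℝ[X] with P = P̃·R, Q = Q̃·R and R(−X) = R(X). Define L = φ*P(D) + Q(D) and Ł = φ*P̃(D) − Q̃(−D), i.e. (Łu)(t) = ∑_k p̃_k u^{(k)}(−t) − ∑_k (−1)^k q̃_k u^{(k)}(t) where p̃_k, q̃_k are the coefficients of P̃ and Q̃. Then for every smooth u : ℝ → ℝ and every t ∈ ℝ, Ł(Lu)(t) = L(Łu)(t), and both are equal to (S(D)u)(t) where S(X) := (P̃(−X)P̃(X) − Q̃(−X)Q̃(X))·R(X) ∈ ℝ[X]. -/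
open Polynomial Finset

section Reflection

variable {A : Type*} [Ring A] [Algebra ℝ A] {r d : A}

theorem aeval_mul_reflection (hd : d * r = r * -d) (p : ℝ[X]) :
    aeval d p * r = r * aeval d (p.comp (-X)) := by
  have h (n : ℕ) : d ^ n * r = r * (-d) ^ n :=
    (SemiconjBy.pow_right (a := r) hd.symm n).symm
  rw [aeval_comp, map_neg, aeval_X, aeval_eq_sum_range, aeval_eq_sum_range, Finset.sum_mul,
    Finset.mul_sum]
  simp only [smul_mul_assoc, mul_smul_comm, h]

theorem aeval_mul_reflection_mul_aeval (hd : d * r = r * -d) (p q : ℝ[X]) :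
    aeval d p * (r * aeval d q) = r * aeval d (p.comp (-X) * q) := by
  rw [← mul_assoc, aeval_mul_reflection hd, mul_assoc, ← map_mul]

theorem reflection_mul_aeval_mul (hr : r * r = 1) (hd : d * r = r * -d) (p q : ℝ[X]) :
    r * aeval d p * (r * aeval d q) = aeval d (p.comp (-X) * q) := by
  rw [mul_assoc, aeval_mul_reflection_mul_aeval hd, ← mul_assoc, hr, one_mul]

theorem reflected_operator_mul (hr : r * r = 1) (hd : d * r = r * -d) {P Q Pt Qt R : ℝ[X]}
    (hP : P = Pt * R) (hQ : Q = Qt * R) :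
    (r * aeval d Pt - aeval d (Qt.comp (-X))) * (r * aeval d P + aeval d Q) =
      aeval d ((Pt.comp (-X) * Pt - Qt.comp (-X) * Qt) * R) := by
  have h₁ : (Pt.comp (-X) * Pt - Qt.comp (-X) * Qt) * R =
      Pt.comp (-X) * P - Qt.comp (-X) * Q := by rw [hP, hQ]; ring
  have h₂ : (Qt.comp (-X)).comp (-X) * P = Pt * Q := by
    rw [comp_neg_X_comp_neg_X, hP, hQ]
    ring
  rw [sub_mul, mul_add, mul_add, reflection_mul_aeval_mul hr hd, mul_assoc,
    aeval_mul_reflection_mul_aeval hd, h₁, h₂, map_sub]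
  simp only [map_mul]
  abel

theorem operator_mul_reflected (hr : r * r = 1) (hd : d * r = r * -d) {P Q Pt Qt R : ℝ[X]}
    (hP : P = Pt * R) (hQ : Q = Qt * R) (hR : R.comp (-X) = R) :
    (r * aeval d P + aeval d Q) * (r * aeval d Pt - aeval d (Qt.comp (-X))) =
      aeval d ((Pt.comp (-X) * Pt - Qt.comp (-X) * Qt) * R) := by
  have h₁ : (Pt.comp (-X) * Pt - Qt.comp (-X) * Qt) * R =
      P.comp (-X) * Pt - Q * Qt.comp (-X) := by rw [hP, hQ, mul_comp, hR]; ring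
  have h₂ : Q.comp (-X) * Pt = P * Qt.comp (-X) := by rw [hP, hQ, mul_comp, hR]; ring
  rw [add_mul, mul_sub, mul_sub, reflection_mul_aeval_mul hr hd, mul_assoc r,
    aeval_mul_reflection_mul_aeval hd, h₁, h₂, map_sub]
  simp only [map_mul]
  abel

end Reflection

/-- The space of smooth real functions of a real variable. -/
def smoothFunctions : Submodule ℝ (ℝ → ℝ) where
  carrier := {u | ContDiff ℝ (⊤ : ℕ∞) u}
  add_mem' hu hv := Set.mem_ofPred.2 ((Set.mem_ofPred.1 hu).add (Set.mem_ofPred.1 hv))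
  zero_mem' := Set.mem_ofPred.2 (contDiff_const (c := (0 : ℝ)))
  smul_mem' c _ hu := Set.mem_ofPred.2 ((Set.mem_ofPred.1 hu).const_smul c)

theorem mem_smoothFunctions {u : ℝ → ℝ} :
    u ∈ smoothFunctions ↔ ContDiff ℝ (⊤ : ℕ∞) u :=
  Set.mem_ofPred

/-- Differentiation as an endomorphism of the smooth functions. -/
noncomputable def smoothDeriv : Module.End ℝ smoothFunctions where
  toFun u := ⟨deriv u.1,
    mem_smoothFunctions.2 (contDiff_infty_iff_deriv.1 (mem_smoothFunctions.1 u.2)).2⟩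
  map_add' u v := Subtype.ext <| funext fun _ => deriv_add
    ((contDiff_infty_iff_deriv.1 (mem_smoothFunctions.1 u.2)).1 _)
    ((contDiff_infty_iff_deriv.1 (mem_smoothFunctions.1 v.2)).1 _)
  map_smul' c u := Subtype.ext <| funext fun _ => deriv_const_smul c
    ((contDiff_infty_iff_deriv.1 (mem_smoothFunctions.1 u.2)).1 _)

/-- The pullback by `t ↦ -t` as an endomorphism of the smooth functions. -/
def smoothReflect : Module.End ℝ smoothFunctions where
  toFun u := ⟨fun t => u.1 (-t),
    mem_smoothFunctions.2 ((mem_smoothFunctions.1 u.2).comp contDiff_neg)⟩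
  map_add' _ _ := rfl
  map_smul' _ _ := rfl

theorem smoothReflect_mul_self : smoothReflect * smoothReflect = 1 := by
  ext u t
  exact congrArg u.1 (neg_neg t)

theorem smoothDeriv_mul_smoothReflect :
    smoothDeriv * smoothReflect = smoothReflect * -smoothDeriv := by
  ext u t
  exact deriv_comp_neg u.1 t

theorem smoothDeriv_pow_apply (n : ℕ) (u : smoothFunctions) :
    ((smoothDeriv ^ n) u).1 = iteratedDeriv n u.1 := by
  induction n with
  | zero => simp
  | succ n ih =>
    rw [pow_succ', iteratedDeriv_succ, ← ih]
    rfl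

theorem aeval_smoothDeriv_apply (p : ℝ[X]) (u : smoothFunctions) (t : ℝ) :
    (aeval smoothDeriv p u).1 t =
      ∑ k ∈ range (p.natDegree + 1), p.coeff k * iteratedDeriv k u.1 t := by
  rw [aeval_eq_sum_range]
  simp [LinearMap.sum_apply, Finset.sum_apply, smoothDeriv_pow_apply]

theorem aeval_smoothDeriv_comp_neg_apply (p : ℝ[X]) (u : smoothFunctions) (t : ℝ) :
    (aeval smoothDeriv (p.comp (-X)) u).1 t =
      ∑ k ∈ range (p.natDegree + 1), (-1 : ℝ) ^ k * p.coeff k * iteratedDeriv k u.1 t := by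
  rw [aeval_smoothDeriv_apply]
  have hd : (p.comp (-X)).natDegree = p.natDegree := by simp [natDegree_comp]
  have hc : p.comp (-X) = p.comp (C (-1) * X) := by simp
  rw [hd, hc]
  simp only [comp_C_mul_X_coeff, mul_comm (p.coeff _)]

/-- For `P = P̃·R`, `Q = Q̃·R` with `R(−X) = R(X)`, the operators
`L = φ*P(D) + Q(D)` and `Lhat = φ*P̃(D) − Q̃(−D)` commute and
`Lhat L = L Lhat = S(D)` where `S(X) = (P̃(−X)P̃(X) − Q̃(−X)Q̃(X))·R(X)`. -/
theorem stmt_1 (P Q R Pt Qt : Polynomial ℝ)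
    (hP : P = Pt * R) (hQ : Q = Qt * R)
    (hR : R.comp (-Polynomial.X) = R)
    (L Lhat : (ℝ → ℝ) → (ℝ → ℝ))
    (hL : ∀ (u : ℝ → ℝ) (t : ℝ), L u t =
      (∑ k ∈ Finset.range (Q.natDegree + 1), Q.coeff k * iteratedDeriv k u t)
        + ∑ k ∈ Finset.range (P.natDegree + 1), P.coeff k * iteratedDeriv k u (-t))
    (hLhat : ∀ (u : ℝ → ℝ) (t : ℝ), Lhat u t =
      (∑ k ∈ Finset.range (Pt.natDegree + 1), Pt.coeff k * iteratedDeriv k u (-t))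
        - ∑ k ∈ Finset.range (Qt.natDegree + 1), (-1 : ℝ) ^ k * Qt.coeff k * iteratedDeriv k u t)
    (S : Polynomial ℝ)
    (hS : S = (Pt.comp (-Polynomial.X) * Pt - Qt.comp (-Polynomial.X) * Qt) * R)
    (u : ℝ → ℝ) (hu : ContDiff ℝ (⊤ : ℕ∞) u) (t : ℝ) :
    Lhat (L u) t = L (Lhat u) t ∧
    Lhat (L u) t = ∑ k ∈ Finset.range (S.natDegree + 1), S.coeff k * iteratedDeriv k u t := by
  have hL' (v : smoothFunctions) : L v.1 =
      ((smoothReflect * aeval smoothDeriv P + aeval smoothDeriv Q) v).1 := by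
    funext s
    rw [hL, ← aeval_smoothDeriv_apply, ← aeval_smoothDeriv_apply, add_comm]
    rfl
  have hLhat' (v : smoothFunctions) : Lhat v.1 =
      ((smoothReflect * aeval smoothDeriv Pt - aeval smoothDeriv (Qt.comp (-X))) v).1 := by
    funext s
    rw [hLhat, ← aeval_smoothDeriv_apply, ← aeval_smoothDeriv_comp_neg_apply]
    rfl
  let v : smoothFunctions := ⟨u, mem_smoothFunctions.2 hu⟩
  have h₁ : Lhat (L u) = (aeval smoothDeriv S v).1 := by
    rw [hS, ← reflected_operator_mul (A := Module.End ℝ smoothFunctions)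
      smoothReflect_mul_self smoothDeriv_mul_smoothReflect hP hQ,
      Module.End.mul_apply, ← hLhat', ← hL']
  have h₂ : L (Lhat u) = (aeval smoothDeriv S v).1 := by
    rw [hS, ← operator_mul_reflected (A := Module.End ℝ smoothFunctions)
      smoothReflect_mul_self smoothDeriv_mul_smoothReflect hP hQ hR,
      Module.End.mul_apply, ← hL', ← hLhat']
  exact ⟨by rw [h₁, h₂], by rw [h₁, aeval_smoothDeriv_apply]⟩
end

section
/- Let n ∈ ℕ, T > 0, A, B, F, G, C, K ∈ M_n(ℝ) with F+G and F−G invertible, γ : ℝ → ℝ^n continuous, and δ ∈ ℝ^n. Let X, Y : ℝ → M_n(ℝ) be differentiable with F X'(t) + G X'(−t) + A X(t) + B X(−t) = 0 and F Y'(t) − G Y'(−t) + A Y(t) − B Y(−t) = 0 for all t ∈ ℝ, with X(0), Y(0) invertible, and assume 𝒳(s) is invertible for every s ∈ [−T,T]. Then the following are equivalent: (a) there exists a differentiable u : ℝ → ℝ^n with F u'(t) + G u'(−t) + A u(t) + B u(−t) = γ(t) for all t ∈ [−T,T] and C·u(−T) + K·u(T) = δ, and any two such functions agree on [−T,T]; (b)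 the matrix M_X := C·X(−T) + K·X(T) is invertible. -/
open Matrix

/-- Even part of a matrix-valued function: `Z_e(t) = (Z(t) + Z(−t))/2`. -/
noncomputable def evenPartR {n : ℕ} (Z : ℝ → Matrix (Fin n) (Fin n) ℝ) (t : ℝ) :
    Matrix (Fin n) (Fin n) ℝ :=
  (2 : ℝ)⁻¹ • (Z t + Z (-t))

/-- Odd part of a matrix-valued function: `Z_o(t) = (Z(t) − Z(−t))/2`. -/
noncomputable def oddPartR {n : ℕ} (Z : ℝ → Matrix (Fin n) (Fin n) ℝ) (t : ℝ) :
    Matrix (Fin n) (Fin n) ℝ :=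
  (2 : ℝ)⁻¹ • (Z t - Z (-t))

/-- The block matrix `𝒳(t)` with block rows `(X_e(t), Y_o(t))` and `(X_o(t), Y_e(t))`. -/
noncomputable def scrX {n : ℕ} (X Y : ℝ → Matrix (Fin n) (Fin n) ℝ) (t : ℝ) :
    Matrix (Fin n ⊕ Fin n) (Fin n ⊕ Fin n) ℝ :=
  Matrix.fromBlocks (evenPartR X t) (oddPartR Y t) (oddPartR X t) (evenPartR Y t)

/-- Duhamel's formula: a linear equation with constant coefficients and a continuous forcing term
has a global solution. -/
theorem exists_hasDerivAt_linear_add {E : Type*} [NormedAddCommGroup E] [NormedSpace ℝ E]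
    [CompleteSpace E] (L : E →L[ℝ] E) {g : ℝ → E} (hg : Continuous g) :
    ∃ w : ℝ → E, ∀ t, HasDerivAt w (L (w t) + g t) t := by
  have hexp : ∀ t : ℝ, HasDerivAt (fun s : ℝ => NormedSpace.exp (s • L))
      (L * NormedSpace.exp (t • L)) t := fun t => hasDerivAt_exp_smul_const' L t
  have hcont : Continuous fun s : ℝ => NormedSpace.exp (s • L) :=
    continuous_iff_continuousAt.2 fun t => (hexp t).continuousAt
  have hf : Continuous fun s : ℝ => NormedSpace.exp ((-s) • L) (g s) :=
    (hcont.comp continuous_neg).clm_apply hg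
  refine ⟨fun t => NormedSpace.exp (t • L) (∫ s in (0 : ℝ)..t, NormedSpace.exp ((-s) • L) (g s)),
    fun t => ?_⟩
  convert (hexp t).clm_apply (hf.integral_hasStrictDerivAt 0 t).hasDerivAt using 1
  have hcancel : NormedSpace.exp (t • L) * NormedSpace.exp ((-t) • L) = 1 := by
    rw [neg_smul]
    let _ : NormedAlgebra ℚ (E →L[ℝ] E) := NormedAlgebra.restrictScalars ℚ ℝ _
    rw [← NormedSpace.exp_add_of_commute (Commute.refl (t • L)).neg_right, add_neg_cancel,
      NormedSpace.exp_zero]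
  have hg' := congrArg (fun S : E →L[ℝ] E => S (g t)) hcancel
  simp only [mul_apply_eq_comp, one_apply_eq_self] at hg' ⊢
  rw [hg']

/-- A solution of a homogeneous linear equation on `[-T, T]` that vanishes at `0` is zero. -/
theorem eq_zero_of_hasDerivAt_linear {E : Type*} [NormedAddCommGroup E] [NormedSpace ℝ E]
    (L : E →L[ℝ] E) {T : ℝ} (hT : 0 < T) {w : ℝ → E}
    (hw : ∀ t ∈ Set.Icc (-T) T, HasDerivAt w (L (w t)) t) (h0 : w 0 = 0) :
    ∀ t ∈ Set.Icc (-T) T, w t = 0 := by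
  exact ODE_solution_unique_of_mem_Icc (v := fun _ => L) (s := fun _ => Set.univ)
    (K := ‖L‖₊) (f := w) (g := fun _ => 0) (t₀ := 0) (a := -T) (b := T)
    (fun _ _ => L.lipschitz.lipschitzOnWith) ⟨by linarith, hT⟩
    (fun t ht => (hw t ht).continuousAt.continuousWithinAt)
    (fun t ht => hw t (Set.Ioo_subset_Icc_self ht)) (fun _ _ => Set.mem_univ _)
    continuousOn_const (fun t _ => by simpa using hasDerivAt_const t (0 : E))
    (fun _ _ => Set.mem_univ _) h0

/-- The linear map `(p, q) ↦ (R q, S p)`. -/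
noncomputable def crossCLM {n : ℕ} (R S : Matrix (Fin n) (Fin n) ℝ) :
    ((Fin n → ℝ) × (Fin n → ℝ)) →L[ℝ] ((Fin n → ℝ) × (Fin n → ℝ)) :=
  ((Matrix.mulVecLin R).toContinuousLinearMap.comp (ContinuousLinearMap.snd ℝ _ _)).prod
    ((Matrix.mulVecLin S).toContinuousLinearMap.comp (ContinuousLinearMap.fst ℝ _ _))

theorem crossCLM_apply {n : ℕ} (R S : Matrix (Fin n) (Fin n) ℝ)
    (z : (Fin n → ℝ) × (Fin n → ℝ)) : crossCLM R S z = (R *ᵥ z.2, S *ᵥ z.1) := rfl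

theorem HasDerivAt.comp_neg' {E : Type*} [NormedAddCommGroup E] [NormedSpace ℝ E] {f : ℝ → E}
    {f' : E} {t : ℝ} (hf : HasDerivAt f f' (-t)) : HasDerivAt (fun s => f (-s)) (-f') t := by
  simpa [Function.comp_def] using hf.scomp t (hasDerivAt_neg t)

/-- The nonhomogeneous system with reflection has a solution. -/
theorem exists_reflection_solution {n : ℕ} {A B F G : Matrix (Fin n) (Fin n) ℝ}
    (h1 : IsUnit (F + G)) (h2 : IsUnit (F - G)) {γ : ℝ → Fin n → ℝ} (hγ : Continuous γ) :
    ∃ u : ℝ → Fin n → ℝ, Differentiable ℝ u ∧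
      ∀ t, F *ᵥ deriv u t + G *ᵥ deriv u (-t) + A *ᵥ u t + B *ᵥ u (-t) = γ t := by
  obtain ⟨Q, hQ⟩ := h1.exists_right_inv
  obtain ⟨P, hP⟩ := h2.exists_right_inv
  have hcont : Continuous fun t => (P *ᵥ ((2 : ℝ)⁻¹ • (γ t - γ (-t))),
      Q *ᵥ ((2 : ℝ)⁻¹ • (γ t + γ (-t)))) := by fun_prop
  obtain ⟨w, hw⟩ := exists_hasDerivAt_linear_add
    (crossCLM (-(P * (A - B))) (-(Q * (A + B)))) hcont
  obtain ⟨p', hp, ep⟩ : ∃ p' : ℝ → Fin n → ℝ,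
      (∀ t, HasDerivAt (fun s => (w s).1) (p' t) t) ∧
      ∀ t, (F - G) *ᵥ p' t = (2 : ℝ)⁻¹ • (γ t - γ (-t)) - (A - B) *ᵥ (w t).2 := by
    refine ⟨fun t => P *ᵥ ((2 : ℝ)⁻¹ • (γ t - γ (-t)) - (A - B) *ᵥ (w t).2), fun t => ?_,
      fun t => by rw [mulVec_mulVec, hP, one_mulVec]⟩
    refine ((ContinuousLinearMap.fst ℝ _ _).hasFDerivAt.comp_hasDerivAt t (hw t)).congr_deriv ?_
    simp only [crossCLM_apply, map_add, ContinuousLinearMap.coe_fst', neg_mulVec,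
      ← mulVec_mulVec, mulVec_sub]
    abel
  obtain ⟨q', hq, eq⟩ : ∃ q' : ℝ → Fin n → ℝ,
      (∀ t, HasDerivAt (fun s => (w s).2) (q' t) t) ∧
      ∀ t, (F + G) *ᵥ q' t = (2 : ℝ)⁻¹ • (γ t + γ (-t)) - (A + B) *ᵥ (w t).1 := by
    refine ⟨fun t => Q *ᵥ ((2 : ℝ)⁻¹ • (γ t + γ (-t)) - (A + B) *ᵥ (w t).1), fun t => ?_,
      fun t => by rw [mulVec_mulVec, hQ, one_mulVec]⟩
    refine ((ContinuousLinearMap.snd ℝ _ _).hasFDerivAt.comp_hasDerivAt t (hw t)).congr_deriv ?_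
    simp only [crossCLM_apply, map_add, ContinuousLinearMap.coe_snd', neg_mulVec,
      ← mulVec_mulVec, mulVec_sub]
    abel
  have hu : ∀ t, HasDerivAt
      (fun s => (2 : ℝ)⁻¹ • ((w s).1 + (w (-s)).1 + ((w s).2 - (w (-s)).2)))
      ((2 : ℝ)⁻¹ • (p' t + -p' (-t) + (q' t - -q' (-t)))) t := fun t =>
    (((hp t).fun_add (hp (-t)).comp_neg').fun_add
      ((hq t).fun_sub (hq (-t)).comp_neg')).fun_const_smul _
  refine ⟨_, fun t => (hu t).differentiableAt, fun t => ?_⟩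
  have ep1 := ep t
  have ep2 := ep (-t)
  have eq1 := eq t
  have eq2 := eq (-t)
  rw [(hu t).deriv, (hu (-t)).deriv]
  simp only [neg_neg, mulVec_smul, mulVec_add, mulVec_sub, mulVec_neg, add_mulVec,
    sub_mulVec] at ep1 ep2 eq1 eq2 ⊢
  linear_combination (norm := module) (2 : ℝ)⁻¹ • ep1 - (2 : ℝ)⁻¹ • ep2 + (2 : ℝ)⁻¹ • eq1
    + (2 : ℝ)⁻¹ • eq2

/-- A solution of the homogeneous system with reflection on `[-T, T]` that vanishes at `0` is
zero. -/
theorem reflection_solution_eq_zero {n : ℕ} {A B F G : Matrix (Fin n) (Fin n) ℝ}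
    (h1 : IsUnit (F + G)) (h2 : IsUnit (F - G)) {T : ℝ} (hT : 0 < T) {e e' : ℝ → Fin n → ℝ}
    (he : ∀ t, HasDerivAt e (e' t) t)
    (heq : ∀ t ∈ Set.Icc (-T) T, F *ᵥ e' t + G *ᵥ e' (-t) + A *ᵥ e t + B *ᵥ e (-t) = 0)
    (h0 : e 0 = 0) : ∀ t ∈ Set.Icc (-T) T, e t = 0 := by
  obtain ⟨Q, hQ⟩ := h1.exists_left_inv
  obtain ⟨P, hP⟩ := h2.exists_left_inv
  have hw := eq_zero_of_hasDerivAt_linear (crossCLM (-(P * (A - B))) (-(Q * (A + B)))) hT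
    (w := fun t => (e t + e (-t), e t - e (-t))) (fun t ht => ?_) (by simp [h0])
  · intro t ht
    have h := Prod.ext_iff.1 (hw t ht)
    have hs : e t + e (-t) = 0 := h.1
    have hd : e t - e (-t) = 0 := h.2
    linear_combination (norm := module) (2 : ℝ)⁻¹ • hs + (2 : ℝ)⁻¹ • hd
  · have e1 := heq t ht
    have e2 := heq (-t) ⟨by linarith [ht.2], by linarith [ht.1]⟩
    have hn := (he (-t)).comp_neg'
    rw [neg_neg] at e2
    have kp : (F - G) *ᵥ (e' t + -e' (-t)) = -((A - B) *ᵥ (e t - e (-t))) := by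
      simp only [mulVec_add, mulVec_sub, mulVec_neg, sub_mulVec]
      linear_combination e1 - e2
    have kq : (F + G) *ᵥ (e' t - -e' (-t)) = -((A + B) *ᵥ (e t + e (-t))) := by
      simp only [mulVec_add, mulVec_sub, mulVec_neg, add_mulVec]
      linear_combination e1 + e2
    have hder : crossCLM (-(P * (A - B))) (-(Q * (A + B))) (e t + e (-t), e t - e (-t))
        = (e' t + -e' (-t), e' t - -e' (-t)) := by
      rw [crossCLM_apply]
      refine Prod.ext ?_ ?_
      · simp only [neg_mulVec, ← mulVec_mulVec]
        rw [← mulVec_neg, ← kp, mulVec_mulVec, hP, one_mulVec]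
      · simp only [neg_mulVec, ← mulVec_mulVec]
        rw [← mulVec_neg, ← kq, mulVec_mulVec, hQ, one_mulVec]
    rw [hder]
    exact ((he t).fun_add hn).prodMk ((he t).fun_sub hn)

theorem hasDerivAt_mulVec_const {n : ℕ} {X X' : ℝ → Matrix (Fin n) (Fin n) ℝ}
    (hX : ∀ (t : ℝ) (i j : Fin n), HasDerivAt (fun s => X s i j) (X' t i j) t) (c : Fin n → ℝ)
    (t : ℝ) : HasDerivAt (fun s => X s *ᵥ c) (X' t *ᵥ c) t :=
  hasDerivAt_pi.2 fun i => by
    simp only [mulVec, dotProduct]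
    exact HasDerivAt.fun_sum fun j _ => (hX t i j).mul_const (c j)

/-- Existence and uniqueness for the two-point boundary value problem
`F u'(t) + G u'(−t) + A u(t) + B u(−t) = γ(t)` on `[−T,T]`, `C u(−T) + K u(T) = δ`, is
equivalent to invertibility of `M_X = C X(−T) + K X(T)`. -/
theorem stmt_19 (n : ℕ) (T : ℝ) (hT : 0 < T)
    (A B F G C K : Matrix (Fin n) (Fin n) ℝ)
    (h1 : IsUnit (F + G)) (h2 : IsUnit (F - G))
    (γ : ℝ → Fin n → ℝ) (hγ : Continuous γ) (δ : Fin n → ℝ)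
    (X Y X' Y' : ℝ → Matrix (Fin n) (Fin n) ℝ)
    (hXd : ∀ (t : ℝ) (i j : Fin n), HasDerivAt (fun s => X s i j) (X' t i j) t)
    (hYd : ∀ (t : ℝ) (i j : Fin n), HasDerivAt (fun s => Y s i j) (Y' t i j) t)
    (hXeq : ∀ t : ℝ, F * X' t + G * X' (-t) + A * X t + B * X (-t) = 0)
    (hYeq : ∀ t : ℝ, F * Y' t - G * Y' (-t) + A * Y t - B * Y (-t) = 0)
    (hX0 : IsUnit (X 0)) (hY0 : IsUnit (Y 0))
    (hinv : ∀ s ∈ Set.Icc (-T) T, IsUnit (scrX X Y s)) :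
    ((∃ u : ℝ → Fin n → ℝ, Differentiable ℝ u ∧
        (∀ t ∈ Set.Icc (-T) T, F.mulVec (deriv u t) + G.mulVec (deriv u (-t))
          + A.mulVec (u t) + B.mulVec (u (-t)) = γ t) ∧
        C.mulVec (u (-T)) + K.mulVec (u T) = δ) ∧
      (∀ u v : ℝ → Fin n → ℝ,
        Differentiable ℝ u →
        (∀ t ∈ Set.Icc (-T) T, F.mulVec (deriv u t) + G.mulVec (deriv u (-t))
          + A.mulVec (u t) + B.mulVec (u (-t)) = γ t) →
        C.mulVec (u (-T)) + K.mulVec (u T) = δ →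
        Differentiable ℝ v →
        (∀ t ∈ Set.Icc (-T) T, F.mulVec (deriv v t) + G.mulVec (deriv v (-t))
          + A.mulVec (v t) + B.mulVec (v (-t)) = γ t) →
        C.mulVec (v (-T)) + K.mulVec (v T) = δ →
        ∀ t ∈ Set.Icc (-T) T, u t = v t))
    ↔ IsUnit (C * X (-T) + K * X T) := by
  have hXc := hasDerivAt_mulVec_const hXd
  have hXceq : ∀ c t,
      F *ᵥ X' t *ᵥ c + G *ᵥ X' (-t) *ᵥ c + A *ᵥ X t *ᵥ c + B *ᵥ X (-t) *ᵥ c = 0 := by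
    intro c t
    simp only [mulVec_mulVec, ← add_mulVec, hXeq, zero_mulVec]
  have hadd : ∀ (u : ℝ → Fin n → ℝ) (c : Fin n → ℝ), Differentiable ℝ u →
      (∀ t ∈ Set.Icc (-T) T, F *ᵥ deriv u t + G *ᵥ deriv u (-t) + A *ᵥ u t + B *ᵥ u (-t) = γ t) →
      Differentiable ℝ (fun t => u t + X t *ᵥ c) ∧
      ∀ t ∈ Set.Icc (-T) T, F *ᵥ deriv (fun t => u t + X t *ᵥ c) t
        + G *ᵥ deriv (fun t => u t + X t *ᵥ c) (-t) + A *ᵥ (u t + X t *ᵥ c)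
        + B *ᵥ (u (-t) + X (-t) *ᵥ c) = γ t := by
    intro u c hu hueq
    have hd : ∀ t, HasDerivAt (fun t => u t + X t *ᵥ c) (deriv u t + X' t *ᵥ c) t :=
      fun t => (hu t).hasDerivAt.add (hXc c t)
    refine ⟨fun t => (hd t).differentiableAt, fun t ht => ?_⟩
    rw [(hd t).deriv, (hd (-t)).deriv]
    simp only [mulVec_add]
    linear_combination hueq t ht + hXceq c t
  have hbdry : ∀ (u : ℝ → Fin n → ℝ) (c : Fin n → ℝ),
      C *ᵥ (u (-T) + X (-T) *ᵥ c) + K *ᵥ (u T + X T *ᵥ c)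
        = C *ᵥ u (-T) + K *ᵥ u T + (C * X (-T) + K * X T) *ᵥ c := by
    intro u c
    simp only [mulVec_add, add_mulVec, ← mulVec_mulVec]
    abel
  constructor
  · rintro ⟨⟨u, hu, hueq, hub⟩, huniq⟩
    refine Matrix.mulVec_injective_iff_isUnit.1
      ((injective_iff_map_eq_zero (mulVecLin (C * X (-T) + K * X T))).2 fun c hc => ?_)
    rw [mulVecLin_apply] at hc
    obtain ⟨hv, hveq⟩ := hadd u c hu hueq
    have h := huniq _ u hv hveq (by rw [hbdry u c, hc, add_zero, hub]) hu hueq hub 0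
      ⟨by linarith, hT.le⟩
    refine Matrix.mulVec_injective_iff_isUnit.2 hX0 ?_
    rw [mulVec_zero]
    exact add_eq_left.1 h
  · intro hM
    obtain ⟨u₀, hu₀, hu₀eq⟩ := exists_reflection_solution (A := A) (B := B) h1 h2 hγ
    obtain ⟨N, hN⟩ := hM.exists_right_inv
    obtain ⟨R, hR⟩ := hX0.exists_right_inv
    constructor
    · obtain ⟨hv, hveq⟩ := hadd u₀ (N *ᵥ (δ - (C *ᵥ u₀ (-T) + K *ᵥ u₀ T))) hu₀
        fun t _ => hu₀eq t
      refine ⟨_, hv, hveq, ?_⟩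
      rw [hbdry, mulVec_mulVec, hN, one_mulVec, add_sub_cancel]
    · intro u v hu hueq hub hv hveq hvb
      have hz := reflection_solution_eq_zero (A := A) (B := B) h1 h2 hT
        (fun t => ((hu t).hasDerivAt.sub (hv t).hasDerivAt).sub (hXc (R *ᵥ (u 0 - v 0)) t))
        (fun t ht => by
          simp only [Pi.sub_apply, mulVec_sub]
          have h := hXceq (R *ᵥ (u 0 - v 0)) t
          simp only [mulVec_sub] at h
          linear_combination hueq t ht - hveq t ht - h)
        (by simp [mulVec_mulVec, hR])
      have hsol : ∀ t ∈ Set.Icc (-T) T, u t = v t + X t *ᵥ (R *ᵥ (u 0 - v 0)) := fun t ht => by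
        have h : u t - v t - X t *ᵥ (R *ᵥ (u 0 - v 0)) = 0 := hz t ht
        linear_combination h
      have hc : R *ᵥ (u 0 - v 0) = 0 := by
        refine Matrix.mulVec_injective_iff_isUnit.2 hM ?_
        rw [mulVec_zero]
        have h := hbdry v (R *ᵥ (u 0 - v 0))
        rw [← hsol T ⟨by linarith, le_rfl⟩, ← hsol (-T) ⟨le_rfl, by linarith⟩, hub, hvb] at h
        exact left_eq_add.1 h
      intro t ht
      rw [hsol t ht, hc, mulVec_zero, add_zero]
end
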